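/- (Tiling sets are spectral) Let p be an odd prime and suppose E ⊆ (ZMod p)² tiles (ZMod p)² by translation. Then E is a spectral set, i.e., there exists A ⊆ (ZMod p)² such that E is a spectral set with spectrum A. -/

import Mathlib

open Finset

/-- The additive character `χ(u) = exp(2πi u / p)` on `ZMod p`. -/
noncomputable def chi (p : ℕ) (u : ZMod p) : ℂ :=
  Complex.exp (2 * Real.pi * Complex.I * (u.val : ℂ) / (p : ℂ))

/-- Dot product on `(ZMod p)^d`. -/
def dotp {p d : ℕ} (x m : Fin d → ZMod p) : ZMod p := ∑ j, x j * m j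

/-- `(E, A)` is a spectral pair: `A` indexes an orthogonal basis of exponentials for `L²(E)`. -/
def IsSpectralPair (p d : ℕ) (E A : Finset (Fin d → ZMod p)) : Prop :=
  (∀ f : (Fin d → ZMod p) → ℂ, ∃ c : (Fin d → ZMod p) → ℂ,
      ∀ x ∈ E, f x = ∑ a ∈ A, c a * chi p (dotp x a)) ∧
  (∀ a ∈ A, ∀ a' ∈ A, a ≠ a' → ∑ x ∈ E, chi p (dotp x (a - a')) = 0)

/-- `(E, T)` is a tiling pair: every vector has a unique representation `e + t`. -/
def IsTilingPair (p d : ℕ) (E T : Finset (Fin d → ZMod p)) : Prop :=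
  ∀ v : Fin d → ZMod p, ∃! et : (Fin d → ZMod p) × (Fin d → ZMod p),
    et.1 ∈ E ∧ et.2 ∈ T ∧ v = et.1 + et.2

/-- `E` tiles `(ZMod p)^d` by translation. -/
def Tiles (p d : ℕ) (E : Finset (Fin d → ZMod p)) : Prop :=
  ∃ T : Finset (Fin d → ZMod p), IsTilingPair p d E T

section Characters

variable {p d : ℕ}

lemma chi_eq_pow (u : ZMod p) : chi p u = Complex.exp (2 * Real.pi * Complex.I / p) ^ u.val := by
  rw [← Complex.exp_nat_mul, chi]
  congr 1
  ring

lemma dotp_add_left (x y m : Fin d → ZMod p) : dotp (x + y) m = dotp x m + dotp y m :=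
  add_dotProduct x y m

lemma dotp_sub_left (x y m : Fin d → ZMod p) : dotp (x - y) m = dotp x m - dotp y m :=
  sub_dotProduct x y m

lemma dotp_sub_right (x m n : Fin d → ZMod p) : dotp x (m - n) = dotp x m - dotp x n :=
  dotProduct_sub x m n

lemma dotp_smul_right (r : ZMod p) (x m : Fin d → ZMod p) : dotp x (r • m) = r * dotp x m :=
  dotProduct_smul r x m

variable [NeZero p]

lemma chi_eq_stdAddChar (u : ZMod p) : chi p u = ZMod.stdAddChar u := by
  rw [ZMod.stdAddChar_apply, ZMod.toCircle_apply, chi]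

lemma chi_add (u v : ZMod p) : chi p (u + v) = chi p u * chi p v := by
  simp only [chi_eq_stdAddChar, AddChar.map_add_eq_mul]

lemma chi_zero : chi p 0 = 1 := by
  simp [chi_eq_stdAddChar]

lemma sum_chi_mul (b : ZMod p) (hb : b ≠ 0) : ∑ u, chi p (u * b) = 0 := by
  simp_rw [chi_eq_stdAddChar, AddChar.sum_mulShift b (ZMod.isPrimitive_stdAddChar p), if_neg hb,
    Nat.cast_zero]

lemma sum_chi_dotp (m : Fin d → ZMod p) (hm : m ≠ 0) : ∑ v, chi p (dotp v m) = 0 := by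
  obtain ⟨j, hj⟩ := Function.ne_iff.1 hm
  let ψ : AddChar (Fin d → ZMod p) ℂ :=
    { toFun := fun v => chi p (dotp v m)
      map_zero_eq_one' := by simp [dotp, chi_zero]
      map_add_eq_mul' := fun v w => by rw [dotp_add_left, chi_add] }
  refine AddChar.sum_eq_zero_of_ne_one (ψ := ψ) fun h => hj ?_
  have h1 : chi p (dotp (Pi.single j 1) m) = 1 := DFunLike.congr_fun h (Pi.single j 1)
  have h2 : dotp (Pi.single j 1) m = m j := single_one_dotProduct j m
  rw [h2, ← chi_zero (p := p)] at h1
  simp only [chi_eq_stdAddChar] at h1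
  exact ZMod.injective_stdAddChar h1

/-- An orthogonal family of exponentials on `E` with as many members as `E` has points is
complete. -/
lemma isSpectralPair_of_card_eq {E A : Finset (Fin d → ZMod p)} (hcard : #A = #E)
    (horth : ∀ a ∈ A, ∀ a' ∈ A, a ≠ a' → ∑ x ∈ E, chi p (dotp x (a - a')) = 0) :
    IsSpectralPair p d E A := by
  refine ⟨fun f => ?_, horth⟩
  rcases E.eq_empty_or_nonempty with rfl | hE
  · exact ⟨0, by simp⟩
  have hE0 : (#E : ℂ) ≠ 0 := by exact_mod_cast hE.card_pos.ne'
  let M : Matrix E A ℂ := .of fun x a => chi p (dotp x.1 a.1)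
  let N : Matrix A E ℂ := .of fun a x => (#E : ℂ)⁻¹ * chi p (-dotp x.1 a.1)
  have hNM : N * M = 1 := by
    ext a a'
    have key : (N * M) a a' = (#E : ℂ)⁻¹ * ∑ x ∈ E, chi p (dotp x (a'.1 - a.1)) := by
      rw [Matrix.mul_apply, ← Finset.sum_coe_sort E, Finset.mul_sum]
      refine Finset.sum_congr rfl fun x _ => ?_
      simp only [M, N, Matrix.of_apply]
      rw [mul_assoc, ← chi_add, dotp_sub_right, neg_add_eq_sub]
    rw [key]
    by_cases h : a = a'
    · subst h
      simp [dotp, chi_zero, hE0]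
    · rw [horth a' a'.2 a a.2 fun h' => h (Subtype.ext h'.symm), Matrix.one_apply_ne h, mul_zero]
  have hMN : M * N = 1 := (Matrix.mul_eq_one_comm_of_card_eq _ _ _ (by simpa using hcard)).1 hNM
  let g : E → ℂ := fun x => f x
  refine ⟨fun a => if h : a ∈ A then N.mulVec g ⟨a, h⟩ else 0, fun x hx => ?_⟩
  have hg : M.mulVec (N.mulVec g) ⟨x, hx⟩ = f x := by
    rw [Matrix.mulVec_mulVec, hMN, Matrix.one_mulVec]
  rw [← hg, Matrix.mulVec, dotProduct, ← Finset.sum_coe_sort A]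
  refine Finset.sum_congr rfl fun a _ => ?_
  simp only [Finset.coe_mem, dif_pos, Subtype.coe_eta]
  exact mul_comm _ _

end Characters

/-- If `p` values in `ZMod p` have vanishing character sum, they are pairwise distinct. -/
lemma injOn_of_sum_chi_eq_zero {p : ℕ} (hp : p.Prime) {α : Type*} {s : Finset α} {φ : α → ZMod p}
    (hs : #s = p) (h : ∑ x ∈ s, chi p (φ x) = 0) : Set.InjOn φ s := by
  have : NeZero p := ⟨hp.ne_zero⟩
  let g : α → Fin p := fun x => ⟨(φ x).val, ZMod.val_lt _⟩
  have hsum : ∑ i : Fin p, ((#{x ∈ s | g x = i} : ℤ) : ℂ) *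
      Complex.exp (2 * Real.pi * Complex.I / p) ^ i.val = 0 := by
    rw [← h, ← Finset.sum_fiberwise s g]
    refine Finset.sum_congr rfl fun i _ => ?_
    rw [Finset.sum_congr rfl (g := fun _ => Complex.exp (2 * Real.pi * Complex.I / p) ^ i.val)]
    · simp
    · intro x hx
      rw [chi_eq_pow, ← (Finset.mem_filter.1 hx).2]
  have heq := ((Complex.isPrimitiveRoot_exp p hp.ne_zero).sum_eq_zero_iff_forall_eq_int hp _).1 hsum
  have hone (i : Fin p) : #{x ∈ s | g x = i} = 1 := by
    have hc := Finset.card_eq_sum_card_fiberwise (f := g) (s := s) (t := univ) (by simp)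
    rw [Finset.sum_congr rfl fun j _ => Nat.cast_injective (R := ℤ) (heq j i), hs] at hc
    simpa [hp.ne_zero] using hc
  intro x hx y hy hxy
  refine Finset.card_le_one.1 (hone (g x)).le x ?_ y ?_
  · simpa using hx
  · simpa [g, hxy] using hy

section Tiling

variable {p d : ℕ} [NeZero p] {E T : Finset (Fin d → ZMod p)}

/-- Summing over the whole space amounts to summing over the tiles. -/
lemma IsTilingPair.sum_eq {M : Type*} [AddCommMonoid M] (h : IsTilingPair p d E T)
    (f : (Fin d → ZMod p) → M) : ∑ v, f v = ∑ et ∈ E ×ˢ T, f (et.1 + et.2) := by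
  symm
  refine Finset.sum_bij (fun et _ => et.1 + et.2) (fun _ _ => mem_univ _) ?_ ?_ fun _ _ => rfl
  · intro a ha b hb hab
    rw [Finset.mem_product] at ha hb
    exact (h (a.1 + a.2)).unique ⟨ha.1, ha.2, rfl⟩ ⟨hb.1, hb.2, hab⟩
  · intro v _
    obtain ⟨et, ⟨h1, h2, h3⟩, -⟩ := h v
    exact ⟨et, Finset.mem_product.2 ⟨h1, h2⟩, h3.symm⟩

lemma IsTilingPair.card_mul_card (h : IsTilingPair p d E T) : #E * #T = p ^ d := by
  simpa [ZMod.card] using (h.sum_eq fun _ => (1 : ℕ)).symm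

lemma IsTilingPair.sum_chi_mul_sum_chi (h : IsTilingPair p d E T) {m : Fin d → ZMod p}
    (hm : m ≠ 0) : (∑ x ∈ E, chi p (dotp x m)) * ∑ t ∈ T, chi p (dotp t m) = 0 := by
  rw [Finset.sum_mul_sum, ← Finset.sum_product', ← sum_chi_dotp m hm, h.sum_eq]
  simp only [dotp_add_left, chi_add]

end Tiling

/-- A set of `p` points of `(ZMod p)^d` with injective projection to direction `m` has the line
through `m` as a spectrum. -/
lemma isSpectralPair_line {p d : ℕ} (hp : p.Prime) {E : Finset (Fin d → ZMod p)} (hE : #E = p)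
    {m : Fin d → ZMod p} (hm : m ≠ 0) (hinj : Set.InjOn (fun x => dotp x m) E) :
    ∃ A, IsSpectralPair p d E A := by
  have : Fact p.Prime := ⟨hp⟩
  have hbij : E.image (fun x => dotp x m) = univ :=
    Finset.eq_univ_of_card _ (by rw [Finset.card_image_of_injOn hinj, hE, ZMod.card])
  refine ⟨univ.image fun r : ZMod p => r • m, isSpectralPair_of_card_eq ?_ ?_⟩
  · rw [Finset.card_image_of_injective _ (smul_left_injective _ hm), hE, Finset.card_univ,
      ZMod.card]
  · simp only [Finset.mem_image, mem_univ, true_and, forall_exists_index,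
      forall_apply_eq_imp_iff]
    intro r r' hr
    have hne : r - r' ≠ 0 := sub_ne_zero.2 fun h => hr (by rw [h])
    rw [← sum_chi_mul (r - r') hne, ← hbij, Finset.sum_image hinj]
    simp only [← sub_smul, dotp_smul_right, mul_comm]

/-- The plane contains a nonzero vector orthogonal to any given nonzero vector. -/
lemma exists_ne_zero_dotp_eq_zero {p : ℕ} {v : Fin 2 → ZMod p} (hv : v ≠ 0) :
    ∃ m : Fin 2 → ZMod p, m ≠ 0 ∧ dotp v m = 0 := by
  refine ⟨![-v 1, v 0], fun h => hv ?_, by simp [dotp, Fin.sum_univ_two]; ring⟩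
  have h0 := congr_fun h 0
  have h1 := congr_fun h 1
  ext i
  fin_cases i <;> simp_all

theorem tiling_implies_spectral (p : ℕ) (hp : p.Prime) (hodd : Odd p)
    (E : Finset (Fin 2 → ZMod p)) (htile : Tiles p 2 E) :
    ∃ A : Finset (Fin 2 → ZMod p), IsSpectralPair p 2 E A := by
  have : Fact p.Prime := ⟨hp⟩
  obtain ⟨T, hT⟩ := htile
  have hcard := hT.card_mul_card
  obtain ⟨k, hk, hEk⟩ := (Nat.dvd_prime_pow hp).1 (Dvd.intro _ hcard)
  interval_cases k
  · refine ⟨{0}, isSpectralPair_of_card_eq (by simpa using hEk.symm) ?_⟩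
    rintro a ha a' ha' h
    rw [Finset.mem_singleton] at ha ha'
    exact absurd (ha.trans ha'.symm) h
  · rw [pow_one] at hEk
    have hTp : #T = p := Nat.eq_of_mul_eq_mul_left hp.pos (by rw [← sq, ← hcard, hEk])
    obtain ⟨t, ht, t', ht', hne⟩ := Finset.one_lt_card.1 (hTp ▸ hp.one_lt)
    obtain ⟨m, hm, hdot⟩ := exists_ne_zero_dotp_eq_zero (sub_ne_zero.2 hne)
    rw [dotp_sub_left, sub_eq_zero] at hdot
    have hT0 : ∑ t ∈ T, chi p (dotp t m) ≠ 0 := fun h =>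
      hne (injOn_of_sum_chi_eq_zero hp hTp h ht ht' hdot)
    have hE0 := (mul_eq_zero.1 (hT.sum_chi_mul_sum_chi hm)).resolve_right hT0
    exact isSpectralPair_line hp hEk hm (injOn_of_sum_chi_eq_zero hp hEk hE0)
  · have hE : E = univ := Finset.eq_univ_of_card _ (by simpa [ZMod.card] using hEk)
    subst hE
    exact ⟨univ, isSpectralPair_of_card_eq rfl fun a _ a' _ h =>
      sum_chi_dotp _ (sub_ne_zero.2 h)⟩
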